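/- Let ξ ∈ ℝ with 0 < ξ < α and Λ G(ξ) ≤ λ G(α), and let u ∈ C²([0,R)) with u(0) = ξ and u'(0) = 0 be the solution of the radial Pucci equation for M⁺ on its maximal interval of existence [0,R). Then R = +∞, u is oscillating (it has an unbounded sequence of zeros), u is localized (u(r), u'(r), u''(r) → 0 as r → +∞), and sup_{r ≥ 0} |u(r)| < α. -/

import Mathlib

open Set Filter Topology

/-- Oscillation criterion: a function with `u u'' ≤ K |u u'| / r - c u²`
near infinity vanishes somewhere. -/
lemma exists_zero_of_mul_deriv2_le {u p q : ℝ → ℝ} {M K c : ℝ} (hM : 0 < M)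
    (hc : 0 < c) (hu : ∀ r, M ≤ r → HasDerivAt u (p r) r)
    (hp : ∀ r, M ≤ r → HasDerivAt p (q r) r)
    (h : ∀ r, M ≤ r → u r * q r ≤ K / r * |u r * p r| - c * u r ^ 2) :
    ∃ r, M ≤ r ∧ u r = 0 := by
  by_contra! hne
  set s := min c 1 with hs
  have hs0 : 0 < s := lt_min hc one_pos
  have hsc : s ≤ c := min_le_left _ _
  have hs1 : s ≤ 1 := min_le_right _ _
  set r₁ := max M (K / s) with hr₁
  have hr₁M : M ≤ r₁ := le_max_left _ _
  have hder : ∀ r, r₁ ≤ r → HasDerivAt (fun r => Real.arctan (p r / u r) + s / 2 * r)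
      (1 / (1 + (p r / u r) ^ 2) * ((q r * u r - p r * p r) / u r ^ 2) + s / 2 * 1) r :=
    fun r hr => ((hp r (hr₁M.trans hr)).div (hu r (hr₁M.trans hr))
      (hne r (hr₁M.trans hr))).arctan.add ((hasDerivAt_id r).const_mul _)
  have hanti : AntitoneOn (fun r => Real.arctan (p r / u r) + s / 2 * r) (Ici r₁) := by
    apply antitoneOn_of_hasDerivWithinAt_nonpos (convex_Ici _)
      (HasDerivAt.continuousOn fun r hr => hder r hr)
      (fun r hr => (hder r (interior_subset hr)).hasDerivWithinAt)
    intro r hr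
    have hr' : r₁ ≤ r := interior_subset hr
    have hrM := hr₁M.trans hr'
    have hr0 : 0 < r := hM.trans_le hrM
    have hu0 := hne r hrM
    have hKr : K / r ≤ s := by
      have : K / s ≤ r := (le_max_right _ _).trans hr'
      rw [div_le_iff₀ hs0] at this
      rw [div_le_iff₀ hr0]; linarith
    have h1 : u r * q r ≤ s * |u r * p r| - s * u r ^ 2 := by
      have := h r hrM
      have h2 := mul_le_mul_of_nonneg_right hKr (abs_nonneg (u r * p r))
      nlinarith [sq_nonneg (u r)]
    have h2 : |u r * p r| ≤ (u r ^ 2 + p r ^ 2) / 2 := by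
      rw [abs_le]; constructor <;> nlinarith [sq_nonneg (u r + p r), sq_nonneg (u r - p r)]
    have h3 : 1 / (1 + (p r / u r) ^ 2) * ((q r * u r - p r * p r) / u r ^ 2)
        = (q r * u r - p r * p r) / (u r ^ 2 + p r ^ 2) := by
      have : u r ^ 2 + p r ^ 2 ≠ 0 := by positivity
      field_simp
    have h4 : (q r * u r - p r * p r) / (u r ^ 2 + p r ^ 2) ≤ - (s / 2) := by
      rw [div_le_iff₀ (by positivity)]
      nlinarith [sq_nonneg (p r)]
    rw [h3]; linarith
  have h1 := hanti (self_mem_Ici) (show r₁ + 8 / s ∈ Ici r₁ by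
    simp only [mem_Ici, le_add_iff_nonneg_right]; positivity) (by
    simp only [le_add_iff_nonneg_right]; positivity)
  simp only at h1
  have h2 : s / 2 * (r₁ + 8 / s) = s / 2 * r₁ + 4 := by field_simp; ring
  rw [h2] at h1
  have := Real.arctan_lt_pi_div_two (p r₁ / u r₁)
  have := Real.neg_pi_div_two_lt_arctan (p (r₁ + 8 / s) / u (r₁ + 8 / s))
  linarith [Real.pi_lt_four]

/-- A damped oscillator `u'' + h(u) = O(|u'| / r)` whose energy dissipates at rate at least
`κ u'² / r` and stays below a level under which `x h(x) > 0` comes to rest at the origin. -/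
lemma tendsto_zero_of_damped {u p q h H : ℝ → ℝ} {α B K κ E₁ : ℝ} (hα : 0 < α) (hκ : 0 < κ)
    (hK : 0 ≤ K) (hh : Continuous h) (hH : ∀ t, HasDerivAt H (h t) t) (hH0 : H 0 = 0)
    (hHpos : ∀ x, |x| ≤ α → x ≠ 0 → 0 < H x)
    (hu : ∀ r, 1 ≤ r → HasDerivAt u (p r) r) (hp : ∀ r, 1 ≤ r → HasDerivAt p (q r) r)
    (huα : ∀ r, 1 ≤ r → |u r| ≤ α) (hpB : ∀ r, 1 ≤ r → |p r| ≤ B)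
    (hA : ∀ r, 1 ≤ r → |q r + h (u r)| ≤ K * |p r| / r)
    (hB : ∀ r, 1 ≤ r → p r * (q r + h (u r)) ≤ -(κ * p r ^ 2 / r))
    (hE : ∀ r, 1 ≤ r → p r ^ 2 / 2 + H (u r) ≤ E₁)
    (hpos : ∀ x, |x| ≤ α → H x ≤ E₁ → x ≠ 0 → 0 < x * h x) :
    Tendsto u atTop (𝓝 0) ∧ Tendsto p atTop (𝓝 0) := by
  have hHc : Continuous H := continuous_iff_continuousAt.2 fun t => (hH t).continuousAt
  have hHnn : ∀ x, |x| ≤ α → 0 ≤ H x := fun x hx => by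
    rcases eq_or_ne x 0 with rfl | h0
    · exact hH0.ge
    · exact (hHpos x hx h0).le
  have hB0 : 0 ≤ B := (abs_nonneg _).trans (hpB 1 le_rfl)
  have hEder : ∀ r, 1 ≤ r → HasDerivAt (fun r => p r ^ 2 / 2 + H (u r))
      (p r * (q r + h (u r))) r := fun r hr => by
    refine ((((hp r hr).pow 2).div_const 2).add ((hH (u r)).comp r (hu r hr))).congr_deriv ?_
    push_cast; ring
  have hEanti : AntitoneOn (fun r => p r ^ 2 / 2 + H (u r)) (Ici 1) := by
    apply antitoneOn_of_hasDerivWithinAt_nonpos (convex_Ici _)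
      (HasDerivAt.continuousOn fun r hr => hEder r hr)
      (fun r hr => (hEder r (interior_subset hr)).hasDerivWithinAt)
    intro r hr
    have hr' : 1 ≤ r := interior_subset hr
    have : 0 ≤ κ * p r ^ 2 / r := by positivity
    linarith [hB r hr']
  have hEsmall : ∀ e > 0, ∃ r, 1 ≤ r ∧ p r ^ 2 / 2 + H (u r) < e := by
    intro e he
    by_contra! hcon
    have hcomp : IsCompact {z : ℝ × ℝ | z ∈ Icc (-α) α ×ˢ Icc (-B) B ∧
        e ≤ z.2 ^ 2 / 2 + H z.1 ∧ H z.1 ≤ E₁} := by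
      have h1 : Continuous fun z : ℝ × ℝ => z.2 ^ 2 / 2 + H z.1 := by fun_prop
      have h2 : Continuous fun z : ℝ × ℝ => H z.1 := by fun_prop
      exact (isCompact_Icc.prod isCompact_Icc).inter_right
        ((isClosed_le continuous_const h1).inter (isClosed_le h2 continuous_const))
    have hmem : ∀ r, 1 ≤ r → (u r, p r) ∈ {z : ℝ × ℝ | z ∈ Icc (-α) α ×ˢ Icc (-B) B ∧
        e ≤ z.2 ^ 2 / 2 + H z.1 ∧ H z.1 ≤ E₁} := fun r hr =>
      ⟨⟨abs_le.1 (huα r hr), abs_le.1 (hpB r hr)⟩, hcon r hr, by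
        linarith [hE r hr, sq_nonneg (p r)]⟩
    obtain ⟨z, hz, hmin⟩ := hcomp.exists_isMinOn ⟨_, hmem 1 le_rfl⟩
      (f := fun z : ℝ × ℝ => z.2 ^ 2 + z.1 * h z.1) (by fun_prop)
    set δ := z.2 ^ 2 + z.1 * h z.1 with hδ
    have hδ0 : 0 < δ := by
      obtain ⟨⟨hz1, hz2⟩, hz3, hz4⟩ := hz
      rcases eq_or_ne z.1 0 with h0 | h0
      · rw [h0, hH0] at hz3
        rw [hδ, h0]; nlinarith
      · have := hpos z.1 (abs_le.2 hz1) hz4 h0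
        nlinarith [sq_nonneg z.2]
    have hδle : ∀ r, 1 ≤ r → δ ≤ p r ^ 2 + u r * h (u r) := fun r hr => hmin (hmem r hr)
    set C := α * K * B + α * B with hC
    have hC0 : 0 ≤ C := by positivity
    set r₁ := max 1 (2 * C / δ) with hr₁
    have h1r : 1 ≤ r₁ := le_max_left _ _
    have hder : ∀ r, r₁ ≤ r → HasDerivAt
        (fun r => p r ^ 2 / 2 + H (u r) + κ / 2 * (u r * p r / r) + κ / 2 * δ / 2 * Real.log r)
        (p r * (q r + h (u r)) + κ / 2 * (((p r * p r + u r * q r) * r - u r * p r * 1) / r ^ 2)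
          + κ / 2 * δ / 2 * r⁻¹) r := fun r hr => by
      have hr1 := h1r.trans hr
      exact ((hEder r hr1).add ((((hu r hr1).mul (hp r hr1)).div (hasDerivAt_id r)
        (by simp; linarith)).const_mul _)).add
        ((Real.hasDerivAt_log (by linarith)).const_mul _)
    have hanti : AntitoneOn (fun r => p r ^ 2 / 2 + H (u r) + κ / 2 * (u r * p r / r)
        + κ / 2 * δ / 2 * Real.log r) (Ici r₁) := by
      apply antitoneOn_of_hasDerivWithinAt_nonpos (convex_Ici _)
        (HasDerivAt.continuousOn fun r hr => hder r hr)
        (fun r hr => (hder r (interior_subset hr)).hasDerivWithinAt)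
      intro r hr
      have hr' : r₁ ≤ r := interior_subset hr
      have hr1 := h1r.trans hr'
      have hr0 : 0 < r := by linarith
      have hup : |u r * p r| ≤ α * B := by
        rw [abs_mul]; exact mul_le_mul (huα r hr1) (hpB r hr1) (abs_nonneg _) hα.le
      have huq : u r * q r ≤ - (u r * h (u r)) + α * K * B / r := by
        have h1 : u r * (q r + h (u r)) ≤ α * (K * B / r) := by
          refine (le_abs_self _).trans ?_
          rw [abs_mul]
          refine mul_le_mul (huα r hr1) ((hA r hr1).trans ?_) (abs_nonneg _) hα.le
          gcongr; exact hpB r hr1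
        have : α * (K * B / r) = α * K * B / r := by ring
        linarith
      have hCr : C / r ≤ δ / 2 := by
        have : 2 * C / δ ≤ r := (le_max_right _ _).trans hr'
        rw [div_le_iff₀ hδ0] at this
        rw [div_le_iff₀ hr0]; linarith
      have e1 : p r * (q r + h (u r)) + κ / 2 * (((p r * p r + u r * q r) * r - u r * p r * 1)
          / r ^ 2) + κ / 2 * δ / 2 * r⁻¹ = p r * (q r + h (u r)) + κ * p r ^ 2 / r
          + κ / (2 * r) * (u r * q r - p r ^ 2 - (u r * p r) / r + δ / 2) := by
        field_simp; ring
      have e2 : α * K * B / r + α * B / r = C / r := by rw [hC]; ring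
      have e3 : -(u r * p r) / r ≤ α * B / r := by
        gcongr; exact (neg_le_abs _).trans hup
      have e4 : u r * q r - p r ^ 2 - (u r * p r) / r + δ / 2 ≤ 0 := by
        rw [neg_div] at e3
        linarith [hδle r hr1]
      rw [e1]
      have e5 : κ / (2 * r) * (u r * q r - p r ^ 2 - (u r * p r) / r + δ / 2) ≤ 0 :=
        mul_nonpos_of_nonneg_of_nonpos (by positivity) e4
      linarith [hB r hr1]
    have hlog : Tendsto (fun r => κ / 2 * δ / 2 * Real.log r) atTop atTop :=
      Real.tendsto_log_atTop.const_mul_atTop (by positivity)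
    obtain ⟨r, hr, hr'⟩ := ((hlog.eventually_gt_atTop (p r₁ ^ 2 / 2 + H (u r₁)
      + κ / 2 * (u r₁ * p r₁ / r₁) + κ / 2 * δ / 2 * Real.log r₁ + κ / 2 * (α * B))).and
      (eventually_ge_atTop r₁)).exists
    have h1 := hanti self_mem_Ici hr' hr'
    simp only at h1
    have hr1 := h1r.trans hr'
    have hup : |u r * p r| ≤ α * B := by
      rw [abs_mul]; exact mul_le_mul (huα r hr1) (hpB r hr1) (abs_nonneg _) hα.le
    have h2 : -(α * B) ≤ u r * p r / r := by
      rw [le_div_iff₀ (by linarith)]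
      nlinarith [neg_le_of_abs_le hup, mul_nonneg hα.le hB0]
    have h3 := mul_le_mul_of_nonneg_left h2 (by positivity : 0 ≤ κ / 2)
    linarith [hHnn _ (huα r hr1), sq_nonneg (p r)]
  have hEev : ∀ e > 0, ∀ᶠ r in atTop, 1 ≤ r ∧ p r ^ 2 / 2 + H (u r) < e := by
    intro e he
    obtain ⟨r₀, h1, h2⟩ := hEsmall e he
    filter_upwards [eventually_ge_atTop r₀] with r hr
    exact ⟨h1.trans hr, (hEanti h1 (h1.trans hr) hr).trans_lt h2⟩
  constructor
  · rw [Metric.tendsto_nhds]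
    intro ε hε
    have hcomp : IsCompact {x : ℝ | x ∈ Icc (-α) α ∧ ε ≤ |x|} :=
      isCompact_Icc.inter_right (isClosed_le continuous_const continuous_abs)
    obtain ⟨m, hm0, hm⟩ : ∃ m > 0, ∀ x, |x| ≤ α → ε ≤ |x| → m ≤ H x := by
      rcases {x : ℝ | x ∈ Icc (-α) α ∧ ε ≤ |x|}.eq_empty_or_nonempty with hemp | hne
      · exact ⟨1, one_pos, fun x h1 h2 => (hemp.subset ⟨abs_le.1 h1, h2⟩).elim⟩
      · obtain ⟨x, hx, hmin⟩ := hcomp.exists_isMinOn hne hHc.continuousOn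
        exact ⟨H x, hHpos x (abs_le.2 hx.1) (abs_pos.1 (hε.trans_le hx.2)),
          fun y h1 h2 => hmin ⟨abs_le.1 h1, h2⟩⟩
    filter_upwards [hEev m hm0] with r ⟨hr1, hr⟩
    rw [Real.dist_eq, sub_zero]
    by_contra! hcon
    linarith [hm _ (huα r hr1) hcon, sq_nonneg (p r)]
  · rw [Metric.tendsto_nhds]
    intro ε hε
    filter_upwards [hEev (ε ^ 2 / 2) (by positivity)] with r ⟨hr1, hr⟩
    rw [Real.dist_eq, sub_zero]
    exact abs_lt_of_sq_lt_sq (by linarith [hHnn _ (huα r hr1)]) hε.le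

/-- A bounded solution of an ODE on `(0, ρ)` extends past `ρ`. -/
lemma exists_continuation {E : Type*} [NormedAddCommGroup E] [NormedSpace ℝ E] [CompleteSpace E]
    {F : ℝ → E → E} {ρ A : ℝ} (hρ : 0 < ρ)
    (hlip : ∀ M, ∃ K, ∀ t, ρ / 2 ≤ t → LipschitzOnWith K (F t) (Metric.closedBall 0 M))
    (hF0 : ∀ t, F t 0 = 0) (hcont : ∀ x, ContinuousOn (F · x) (Ici (ρ / 2))) {x : ℝ → E}
    (hx : ∀ t ∈ Ioo 0 ρ, HasDerivAt x (F t (x t)) t) (hA : ∀ t ∈ Ioo 0 ρ, ‖x t‖ ≤ A) :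
    ∃ r₀ ∈ Ioo 0 ρ, ∃ r₁ > ρ, ∃ y : ℝ → E, ∀ t ∈ Ioo r₀ r₁,
      HasDerivAt y (F t (y t)) t ∧ (t < ρ → y t = x t) := by
  have hA0 : 0 ≤ A := (norm_nonneg _).trans (hA (ρ / 2) ⟨by linarith, by linarith⟩)
  obtain ⟨K, hK⟩ := hlip (A + 1)
  set L : NNReal := K * (A + 1).toNNReal with hL
  set ε : ℝ := 1 / (L + 1) with hε
  have hL0 : (0 : ℝ) ≤ L := L.2
  have hε0 : 0 < ε := by positivity
  have hLε : L * ε ≤ 1 := by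
    rw [hε, mul_one_div, div_le_one (by positivity)]; linarith
  set r₀ := max (ρ / 2) (ρ - ε / 2) with hr₀
  have h1 : ρ / 2 ≤ r₀ := le_max_left _ _
  have h2 : ρ - ε / 2 ≤ r₀ := le_max_right _ _
  have h3 : r₀ < ρ := max_lt (by linarith) (by linarith)
  have hr₀m : r₀ ∈ Ioo 0 ρ := ⟨by linarith, h3⟩
  have hsub : Metric.closedBall (x r₀) 1 ⊆ Metric.closedBall 0 (A + 1) := by
    apply Metric.closedBall_subset_closedBall'
    rw [dist_zero_right]; linarith [hA r₀ hr₀m]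
  have hpl : IsPicardLindelof F (tmin := r₀) (tmax := r₀ + ε) ⟨r₀, le_rfl, by linarith⟩ (x r₀)
      1 0 L K := by
    refine ⟨fun t ht => (hK t (h1.trans ht.1)).mono (by simpa using hsub),
      fun y _ => (hcont y).mono fun t ht => h1.trans ht.1, fun t ht y hy => ?_, ?_⟩
    · have hy' := hsub (by simpa using hy)
      have := (hK t (h1.trans ht.1)).dist_le_mul y hy' 0
        (Metric.mem_closedBall_self (by linarith))
      rw [hF0, dist_zero_right, dist_zero_right] at this
      refine this.trans ?_
      rw [hL, NNReal.coe_mul, Real.coe_toNNReal _ (by linarith)]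
      exact mul_le_mul_of_nonneg_left (by simpa using hy') K.2
    · simp only [add_sub_cancel_left, sub_self, max_eq_left hε0.le]
      simpa using hLε
  obtain ⟨y, hy0, hy⟩ := hpl.exists_eq_forall_mem_Icc_hasDerivWithinAt₀
  simp only at hy0
  refine ⟨r₀, hr₀m, r₀ + ε, by linarith, y, fun t ht =>
    ⟨(hy t (Ioo_subset_Icc_self ht)).hasDerivAt (Icc_mem_nhds ht.1 ht.2), fun htρ => ?_⟩⟩
  have hyc : ContinuousOn y (Icc r₀ t) := fun s hs =>
    ((hy s ⟨hs.1, hs.2.trans ht.2.le⟩).continuousWithinAt).mono (Icc_subset_Icc_right ht.2.le)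
  obtain ⟨M, hM⟩ := (isCompact_Icc.image_of_continuousOn hyc).isBounded.subset_closedBall 0
  obtain ⟨K', hK'⟩ := hlip (max M A)
  have hxd : ∀ s ∈ Icc r₀ t, HasDerivAt x (F s (x s)) s := fun s hs =>
    hx s ⟨hr₀m.1.trans_le hs.1, hs.2.trans_lt htρ⟩
  refine ODE_solution_unique_of_mem_Icc_right (K := K') (v := F)
    (s := fun _ => Metric.closedBall 0 (max M A)) (fun s hs => hK' s (h1.trans hs.1)) hyc
    (fun s hs => ?_) (fun s hs => ?_) (HasDerivAt.continuousOn hxd)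
    (fun s hs => (hxd s (Ico_subset_Icc_self hs)).hasDerivWithinAt) (fun s hs => ?_) hy0
    (right_mem_Icc.2 ht.1.le)
  · exact (hy s ⟨hs.1, (hs.2.trans ht.2).le⟩).mono_of_mem_nhdsWithin
      (mem_of_superset (Icc_mem_nhdsGE (hs.2.trans ht.2)) (Icc_subset_Icc_left hs.1))
  · exact Metric.closedBall_subset_closedBall (le_max_left _ _)
      (hM (mem_image_of_mem _ (Ico_subset_Icc_self hs)))
  · have := hA s ⟨hr₀m.1.trans_le hs.1, hs.2.trans htρ⟩
    simpa using Or.inr this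

/-- The inverse of `x ↦ θ(x) x`, where `θ = Lam` on `x ≥ 0` and `θ = lam` on `x < 0`. -/
noncomputable def pucciInv (lam Lam x : ℝ) : ℝ := min (x / Lam) (x / lam)

/-- The function `x ↦ Θ(x) x`, where `Θ = Lam` on `x ≥ 0` and `Θ = lam` on `x < 0`. -/
noncomputable def pucciMul (lam Lam x : ℝ) : ℝ := max (Lam * x) (lam * x)

section Pucci

variable {lam Lam : ℝ}

lemma pucciInv_of_nonneg (hlam : 0 < lam) (h : lam ≤ Lam) {x : ℝ} (hx : 0 ≤ x) :
    pucciInv lam Lam x = x / Lam :=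
  min_eq_left (div_le_div_of_nonneg_left hx hlam h)

lemma pucciInv_of_nonpos (hlam : 0 < lam) (h : lam ≤ Lam) {x : ℝ} (hx : x ≤ 0) :
    pucciInv lam Lam x = x / lam :=
  min_eq_right (by
    have := div_le_div_of_nonneg_left (neg_nonneg.2 hx) hlam h
    rw [neg_div, neg_div] at this; linarith)

lemma pucciMul_eq_ite (h : lam ≤ Lam) (x : ℝ) :
    pucciMul lam Lam x = (if 0 ≤ x then Lam else lam) * x := by
  unfold pucciMul
  split_ifs with hx
  · exact max_eq_left (by nlinarith)
  · exact max_eq_right (by nlinarith)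

lemma pucciInv_sub (hlam : 0 < lam) (h : lam ≤ Lam) {a b : ℝ} (hab : a ≤ b) :
    (b - a) / Lam ≤ pucciInv lam Lam b - pucciInv lam Lam a ∧
      pucciInv lam Lam b - pucciInv lam Lam a ≤ (b - a) / lam := by
  have key : ∀ x : ℝ, 0 ≤ x → x / Lam ≤ x / lam := fun x hx =>
    div_le_div_of_nonneg_left hx hlam h
  rcases le_total 0 a with ha | ha
  · rw [pucciInv_of_nonneg hlam h ha, pucciInv_of_nonneg hlam h (ha.trans hab), ← sub_div]
    exact ⟨le_rfl, key _ (by linarith)⟩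
  · rw [pucciInv_of_nonpos hlam h ha]
    rcases le_total 0 b with hb | hb
    · rw [pucciInv_of_nonneg hlam h hb, sub_div, sub_div]
      have h1 := key b hb
      have h2 := key (-a) (by linarith)
      rw [neg_div, neg_div] at h2
      constructor <;> linarith
    · rw [pucciInv_of_nonpos hlam h hb, ← sub_div]
      exact ⟨key _ (by linarith), le_rfl⟩

lemma abs_pucciInv_sub_le (hlam : 0 < lam) (h : lam ≤ Lam) (a b : ℝ) :
    |pucciInv lam Lam a - pucciInv lam Lam b| ≤ |a - b| / lam := by
  have hLam := hlam.trans_le h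
  wlog hab : b ≤ a generalizing a b
  · rw [abs_sub_comm, abs_sub_comm a]; exact this _ _ (le_of_not_ge hab)
  have := pucciInv_sub hlam h hab
  rw [abs_of_nonneg (sub_nonneg.2 hab), abs_of_nonneg]
  · exact this.2
  · exact (div_nonneg (sub_nonneg.2 hab) hLam.le).trans this.1

lemma continuous_pucciInv : Continuous (pucciInv lam Lam) :=
  (continuous_id.div_const _).min (continuous_id.div_const _)

lemma continuous_pucciMul : Continuous (pucciMul lam Lam) :=
  (continuous_const.mul continuous_id).max (continuous_const.mul continuous_id)

@[simp] lemma pucciInv_zero : pucciInv lam Lam 0 = 0 := by simp [pucciInv]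

@[simp] lemma pucciMul_zero : pucciMul lam Lam 0 = 0 := by simp [pucciMul]

lemma abs_pucciMul_sub_le (hlam : 0 < lam) (h : lam ≤ Lam) (a b : ℝ) :
    |pucciMul lam Lam a - pucciMul lam Lam b| ≤ Lam * |a - b| := by
  have h1 : |Lam * a - Lam * b| = Lam * |a - b| := by
    rw [← mul_sub, abs_mul, abs_of_pos (hlam.trans_le h)]
  have h2 : |lam * a - lam * b| = lam * |a - b| := by
    rw [← mul_sub, abs_mul, abs_of_pos hlam]
  refine (abs_max_sub_max_le_max _ _ _ _).trans ?_
  rw [h1, h2]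
  exact max_le le_rfl (mul_le_mul_of_nonneg_right h (abs_nonneg _))

lemma abs_pucciMul_le (hlam : 0 < lam) (h : lam ≤ Lam) (a : ℝ) :
    |pucciMul lam Lam a| ≤ Lam * |a| := by
  simpa using abs_pucciMul_sub_le hlam h a 0

lemma le_abs_pucciMul (h : lam ≤ Lam) (a : ℝ) :
    lam * |a| ≤ |pucciMul lam Lam a| := by
  rw [pucciMul_eq_ite h, abs_mul]
  refine mul_le_mul_of_nonneg_right ?_ (abs_nonneg _)
  split_ifs
  · exact h.trans (le_abs_self _)
  · exact le_abs_self _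

lemma mul_ite_eq_iff (hlam : 0 < lam) (h : lam ≤ Lam) {x y : ℝ} :
    (if 0 ≤ x then Lam else lam) * x = y ↔ x = pucciInv lam Lam y := by
  have hLam := hlam.trans_le h
  constructor
  · rintro rfl
    split_ifs with hx
    · rw [pucciInv_of_nonneg hlam h (by positivity)]; field_simp
    · rw [pucciInv_of_nonpos hlam h (by nlinarith)]; field_simp
  · rintro rfl
    rcases le_or_gt 0 y with hy | hy
    · rw [pucciInv_of_nonneg hlam h hy, if_pos (by positivity)]; field_simp
    · rw [pucciInv_of_nonpos hlam h hy.le,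
        if_neg (not_le.2 (div_neg_of_neg_of_pos hy hlam))]
      field_simp

lemma pucci_equation_iff (hlam : 0 < lam) (h : lam ≤ Lam) {k p q y : ℝ} :
    (if 0 ≤ q then Lam else lam) * q + k * ((if 0 ≤ p then Lam else lam) * p) + y = 0 ↔
      q = pucciInv lam Lam (-(k * pucciMul lam Lam p) - y) := by
  rw [← mul_ite_eq_iff hlam h, pucciMul_eq_ite h]
  constructor <;> intro H <;> linarith

lemma pucci_damping (hlam : 0 < lam) (h : lam ≤ Lam) {k : ℝ} (hk : 0 ≤ k) (p y : ℝ) :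
    |pucciInv lam Lam (-(k * pucciMul lam Lam p) - y) - pucciInv lam Lam (-y)|
        ≤ k * Lam / lam * |p| ∧
      p * (pucciInv lam Lam (-(k * pucciMul lam Lam p) - y) - pucciInv lam Lam (-y))
        ≤ -(k * lam / Lam * p ^ 2) := by
  have hLam := hlam.trans_le h
  constructor
  · refine (abs_pucciInv_sub_le hlam h _ _).trans ?_
    have h1 : |(-(k * pucciMul lam Lam p) - y) - -y| = k * |pucciMul lam Lam p| := by
      rw [show (-(k * pucciMul lam Lam p) - y) - -y = -(k * pucciMul lam Lam p) by ring,
        abs_neg, abs_mul, abs_of_nonneg hk]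
    rw [h1, div_le_iff₀ hlam]
    have := mul_le_mul_of_nonneg_left (abs_pucciMul_le hlam h p) hk
    calc _ ≤ _ := this
      _ = _ := by field_simp
  · rcases le_total 0 p with hp | hp
    · have hm : lam * p ≤ pucciMul lam Lam p := le_max_right _ _
      have h0 := mul_nonneg hk ((mul_nonneg hlam.le hp).trans hm)
      have h1 := (pucciInv_sub hlam h
        (show -(k * pucciMul lam Lam p) - y ≤ -y by linarith)).1
      have h2 : k * (lam * p) / Lam ≤ (-y - (-(k * pucciMul lam Lam p) - y)) / Lam := by
        gcongr
        nlinarith [mul_le_mul_of_nonneg_left hm hk]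
      have h3 := mul_le_mul_of_nonneg_left (h2.trans h1) hp
      have h4 : p * (k * (lam * p) / Lam) = k * lam / Lam * p ^ 2 := by ring
      linarith
    · have hm : pucciMul lam Lam p ≤ lam * p := max_le (by nlinarith) le_rfl
      have h0 : k * pucciMul lam Lam p ≤ 0 :=
        mul_nonpos_of_nonneg_of_nonpos hk (hm.trans (by nlinarith))
      have h1 := (pucciInv_sub hlam h
        (show -y ≤ -(k * pucciMul lam Lam p) - y by linarith)).1
      have h2 : -(k * (lam * p)) / Lam ≤ (-(k * pucciMul lam Lam p) - y - -y) / Lam := by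
        gcongr
        nlinarith [mul_le_mul_of_nonneg_left hm hk]
      have h3 := mul_le_mul_of_nonpos_left (h2.trans h1) hp
      have h4 : p * (-(k * (lam * p)) / Lam) = -(k * lam / Lam * p ^ 2) := by ring
      linarith

/-- The first-order system of the radial Pucci equation, with `k = N - 1`. -/
noncomputable def pucciField (lam Lam k : ℝ) (g : ℝ → ℝ) (t : ℝ) (z : ℝ × ℝ) : ℝ × ℝ :=
  (z.2, pucciInv lam Lam (-(k / t * pucciMul lam Lam z.2) - g z.1))

lemma exists_lipschitzOnWith_pucciField (hlam : 0 < lam) (h : lam ≤ Lam) {k : ℝ} (hk : 0 ≤ k)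
    {g : ℝ → ℝ} (hg : LocallyLipschitz g) {τ : ℝ} (hτ : 0 < τ) (M : ℝ) :
    ∃ K, ∀ t, τ ≤ t → LipschitzOnWith K (pucciField lam Lam k g t) (Metric.closedBall 0 M) := by
  have hLam := hlam.trans_le h
  obtain ⟨Kg, hKg⟩ := hg.locallyLipschitzOn.exists_lipschitzOnWith_of_compact
    (isCompact_closedBall (0 : ℝ) M)
  have hC : 0 ≤ (k / τ * Lam + Kg) / lam := by positivity
  refine ⟨(max 1 ((k / τ * Lam + Kg) / lam)).toNNReal, fun t ht =>
    LipschitzOnWith.of_dist_le_mul fun z hz w hw => ?_⟩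
  rw [Real.coe_toNNReal _ (zero_le_one.trans (le_max_left _ _))]
  have hz1 : |z.1 - w.1| ≤ dist z w := le_max_left _ _
  have hz2 : |z.2 - w.2| ≤ dist z w := le_max_right _ _
  have hD : 0 ≤ dist z w := dist_nonneg
  have hfst : ∀ v ∈ Metric.closedBall (0 : ℝ × ℝ) M, v.1 ∈ Metric.closedBall (0 : ℝ) M := by
    intro v hv
    rw [mem_closedBall_zero_iff] at hv ⊢
    exact (norm_fst_le v).trans hv
  have ht0 : 0 < t := hτ.trans_le ht
  refine max_le ?_ ?_
  · refine hz2.trans ?_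
    exact le_mul_of_one_le_left hD (le_max_left _ _)
  · refine le_trans ?_ (mul_le_mul_of_nonneg_right (le_max_right _ _) hD)
    refine (abs_pucciInv_sub_le hlam h _ _).trans ?_
    rw [div_mul_eq_mul_div (k / τ * Lam + Kg)]
    refine div_le_div_of_nonneg_right ?_ hlam.le
    have h1 : |g z.1 - g w.1| ≤ Kg * |z.1 - w.1| := hKg.dist_le_mul _ (hfst z hz) _ (hfst w hw)
    have h2 := abs_pucciMul_sub_le hlam h z.2 w.2
    have h3 : k / t ≤ k / τ := div_le_div_of_nonneg_left hk hτ ht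
    have h4 : 0 ≤ k / t := by positivity
    have h5 : |k / t * (pucciMul lam Lam z.2 - pucciMul lam Lam w.2)|
        ≤ k / τ * Lam * dist z w := by
      rw [abs_mul, abs_of_nonneg h4, mul_assoc]
      refine mul_le_mul h3 (h2.trans ?_) (abs_nonneg _) (h4.trans h3)
      exact mul_le_mul_of_nonneg_left hz2 hLam.le
    have h6 : (Kg : ℝ) * |z.1 - w.1| ≤ Kg * dist z w := mul_le_mul_of_nonneg_left hz1 Kg.2
    calc _ = |k / t * (pucciMul lam Lam z.2 - pucciMul lam Lam w.2) + (g z.1 - g w.1)| := by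
          rw [← abs_neg]; congr 1; ring
      _ ≤ _ := abs_add_le _ _
      _ ≤ _ := by linarith

end Pucci

/-- Energy estimate on an initial interval for `u'' + h(u) = O(|u'| / r)`, `u(0) = ξ`,
`u'(0) = 0`, with dissipation at rate at least `κ u'² / r`. -/
lemma energy_lt_of_damped {u p q h H : ℝ → ℝ} {ξ ρ α K κ : ℝ} (hρ : 0 < ρ) (hκ : 0 < κ)
    (hh : Continuous h) (hH : ∀ t, HasDerivAt H (h t) t) (hhξ : h ξ ≠ 0)
    (hu : ∀ r ∈ Ioc 0 ρ, HasDerivAt u (p r) r) (hp : ∀ r ∈ Ioc 0 ρ, HasDerivAt p (q r) r)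
    (hA : ∀ r ∈ Ioc 0 ρ, |q r + h (u r)| ≤ K * |p r| / r)
    (hB : ∀ r ∈ Ioc 0 ρ, p r * (q r + h (u r)) ≤ -(κ * p r ^ 2 / r))
    (hu0 : Tendsto u (𝓝[>] 0) (𝓝 ξ)) (hp0 : Tendsto p (𝓝[>] 0) (𝓝 0))
    (hξα : |ξ| < α) (hHα : ∀ x, |x| = α → H ξ ≤ H x) :
    p ρ ^ 2 / 2 + H (u ρ) < H ξ ∧ |u ρ| < α := by
  have hHc : Continuous H := continuous_iff_continuousAt.2 fun t => (hH t).continuousAt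
  have hEder : ∀ r ∈ Ioc 0 ρ, HasDerivAt (fun r => p r ^ 2 / 2 + H (u r))
      (p r * (q r + h (u r))) r := fun r hr => by
    refine ((((hp r hr).pow 2).div_const 2).add ((hH (u r)).comp r (hu r hr))).congr_deriv ?_
    push_cast; ring
  have hEanti : AntitoneOn (fun r => p r ^ 2 / 2 + H (u r)) (Ioc 0 ρ) := by
    apply antitoneOn_of_hasDerivWithinAt_nonpos (convex_Ioc _ _)
      (HasDerivAt.continuousOn fun r hr => hEder r hr)
      (fun r hr => (hEder r (interior_subset hr)).hasDerivWithinAt)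
    intro r hr
    have hr' : r ∈ Ioc 0 ρ := interior_subset hr
    have := hr'.1
    have : 0 ≤ κ * p r ^ 2 / r := by positivity
    linarith [hB r hr']
  have hE0 : Tendsto (fun r => p r ^ 2 / 2 + H (u r)) (𝓝[>] 0) (𝓝 (H ξ)) := by
    have := ((hp0.pow 2).div_const 2).add ((hHc.tendsto ξ).comp hu0)
    simpa using this
  have hle : ∀ r ∈ Ioc 0 ρ, p r ^ 2 / 2 + H (u r) ≤ H ξ := fun r hr => by
    refine ge_of_tendsto hE0 ?_
    filter_upwards [Ioo_mem_nhdsGT hr.1] with s hs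
    exact hEanti ⟨hs.1, hs.2.le.trans hr.2⟩ hr hs.2.le
  have hlt : ∀ r ∈ Ioc 0 ρ, p r ^ 2 / 2 + H (u r) < H ξ := by
    intro r hr
    refine lt_of_le_of_ne (hle r hr) fun heq => hhξ ?_
    have hconst : ∀ s ∈ Ioo 0 r, p s ^ 2 / 2 + H (u s) = H ξ := fun s hs =>
      le_antisymm (hle s ⟨hs.1, hs.2.le.trans hr.2⟩)
        (heq ▸ hEanti ⟨hs.1, hs.2.le.trans hr.2⟩ hr hs.2.le)
    have hps : ∀ s ∈ Ioo 0 r, p s = 0 := fun s hs => by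
      have hs' : s ∈ Ioc 0 ρ := ⟨hs.1, hs.2.le.trans hr.2⟩
      have h1 : HasDerivAt (fun r => p r ^ 2 / 2 + H (u r)) 0 s :=
        (hasDerivAt_const s (H ξ)).congr_of_eventuallyEq (by
          filter_upwards [Ioo_mem_nhds hs.1 hs.2] with t ht using hconst t ht)
      have h2 := hB s hs'
      rw [(hEder s hs').unique h1] at h2
      have h3 : κ * p s ^ 2 / s ≤ 0 := by linarith
      rw [div_le_iff₀ hs.1, zero_mul] at h3
      have h4 : p s ^ 2 ≤ 0 := by nlinarith
      exact pow_eq_zero_iff two_ne_zero |>.1 (le_antisymm h4 (sq_nonneg _))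
    have hhs : ∀ s ∈ Ioo 0 r, h (u s) = 0 := fun s hs => by
      have hs' : s ∈ Ioc 0 ρ := ⟨hs.1, hs.2.le.trans hr.2⟩
      have h1 : HasDerivAt p 0 s := (hasDerivAt_const s (0 : ℝ)).congr_of_eventuallyEq (by
          filter_upwards [Ioo_mem_nhds hs.1 hs.2] with t ht using hps t ht)
      have h2 := hA s hs'
      rw [(hp s hs').unique h1, hps s hs] at h2
      simpa using h2
    refine tendsto_nhds_unique ((hh.tendsto ξ).comp hu0) (tendsto_const_nhds.congr' ?_)
    filter_upwards [Ioo_mem_nhdsGT hr.1] with s hs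
    exact (hhs s hs).symm
  refine ⟨hlt ρ ⟨hρ, le_rfl⟩, ?_⟩
  by_contra! hcon
  obtain ⟨s₀, hs₀, hs₀'⟩ := ((hu0.abs.eventually (gt_mem_nhds hξα)).and
    (Ioo_mem_nhdsGT hρ)).exists
  have hcont : ContinuousOn (fun r => |u r|) (Icc s₀ ρ) := fun r hr =>
    (hu r ⟨hs₀'.1.trans_le hr.1, hr.2⟩).continuousAt.abs.continuousWithinAt
  obtain ⟨s, hs, hsα⟩ := intermediate_value_Icc hs₀'.2.le hcont ⟨hs₀.le, hcon⟩
  have := hlt s ⟨hs₀'.1.trans_le hs.1, hs.2⟩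
  linarith [hHα _ hsα, sq_nonneg (p s)]

lemma contDiffOn_two_iff_deriv_of_isOpen {f : ℝ → ℝ} {s : Set ℝ} (hs : IsOpen s) :
    ContDiffOn ℝ 2 f s ↔ DifferentiableOn ℝ f s ∧ DifferentiableOn ℝ (deriv f) s ∧
      ContinuousOn (deriv (deriv f)) s := by
  rw [show (2 : WithTop ℕ∞) = 0 + 1 + 1 by norm_num, contDiffOn_succ_iff_deriv_of_isOpen hs,
    contDiffOn_succ_iff_deriv_of_isOpen hs, contDiffOn_zero]
  simp

lemma contDiffOn_two_of_hasDerivAt {f f' f'' : ℝ → ℝ} {s : Set ℝ} (hs : IsOpen s)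
    (h : ∀ x ∈ s, HasDerivAt f (f' x) x) (h' : ∀ x ∈ s, HasDerivAt f' (f'' x) x)
    (h'' : ContinuousOn f'' s) : ContDiffOn ℝ 2 f s := by
  have e : ∀ x ∈ s, HasDerivAt (deriv f) (f'' x) x := fun x hx =>
    (h' x hx).congr_of_eventuallyEq (by
      filter_upwards [hs.mem_nhds hx] with y hy using (h y hy).deriv)
  exact (contDiffOn_two_iff_deriv_of_isOpen hs).2
    ⟨fun x hx => (h x hx).differentiableAt.differentiableWithinAt,
      fun x hx => (e x hx).differentiableAt.differentiableWithinAt,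
      h''.congr fun x hx => (e x hx).deriv⟩

lemma exists_pucci_continuation {lam Lam k : ℝ} (hlam : 0 < lam) (hle : lam ≤ Lam) (hk : 0 ≤ k)
    {g : ℝ → ℝ} (hg : LocallyLipschitz g) (hg0 : g 0 = 0) {u : ℝ → ℝ} {ρ A : ℝ} (hρ : 0 < ρ)
    (hu : ContDiffOn ℝ 2 u (Ico 0 ρ))
    (hode : ∀ r ∈ Ioo 0 ρ, deriv (deriv u) r
      = pucciInv lam Lam (-(k / r * pucciMul lam Lam (deriv u r)) - g (u r)))
    (huA : ∀ r ∈ Ioo 0 ρ, |u r| ≤ A) (hpA : ∀ r ∈ Ioo 0 ρ, |deriv u r| ≤ A) :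
    ∃ ρ' > ρ, ∃ v : ℝ → ℝ, ContDiffOn ℝ 2 v (Ico 0 ρ') ∧
      (∀ r ∈ Ioo 0 ρ', deriv (deriv v) r
        = pucciInv lam Lam (-(k / r * pucciMul lam Lam (deriv v r)) - g (v r))) ∧
      ∀ r < ρ, v r = u r := by
  obtain ⟨hd, hd', -⟩ := (contDiffOn_two_iff_deriv_of_isOpen isOpen_Ioo).1
    (hu.mono Ioo_subset_Ico_self)
  have hx : ∀ t ∈ Ioo 0 ρ, HasDerivAt (fun t => (u t, deriv u t))
      (pucciField lam Lam k g t (u t, deriv u t)) t := fun t ht => by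
    have hn := Ioo_mem_nhds ht.1 ht.2
    have h1 := (hd.differentiableAt hn).hasDerivAt
    have h2 := (hd'.differentiableAt hn).hasDerivAt
    rw [hode t ht] at h2
    exact h1.prodMk h2
  have hcont : ∀ x, ContinuousOn (pucciField lam Lam k g · x) (Ici (ρ / 2)) := fun x => by
    refine continuousOn_const.prodMk (continuous_pucciInv.comp_continuousOn ?_)
    refine ContinuousOn.sub (ContinuousOn.neg (ContinuousOn.mul ?_ continuousOn_const))
      continuousOn_const
    exact continuousOn_const.div continuousOn_id fun t (ht : ρ / 2 ≤ t) =>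
      ((half_pos hρ).trans_le ht).ne'
  obtain ⟨r₀, hr₀, r₁, hr₁, y, hy⟩ := exists_continuation hρ
    (fun M => exists_lipschitzOnWith_pucciField hlam hle hk hg (half_pos hρ) M)
    (fun t => by simp [pucciField, hg0]) hcont hx
    (fun t ht => max_le (huA t ht) (hpA t ht))
  set v : ℝ → ℝ := fun r => if r < ρ then u r else (y r).1 with hv
  have hvu : ∀ r < ρ, v r = u r := fun r hr => if_pos hr
  have hvy : ∀ r ∈ Ioo r₀ r₁, v r = (y r).1 := fun r hr => by
    by_cases h : r < ρ
    · rw [hvu r h, (hy r hr).2 h]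
    · exact if_neg h
  have hy1 : ∀ r ∈ Ioo r₀ r₁, HasDerivAt (fun t => (y t).1) (y r).2 r := fun r hr =>
    (hasFDerivAt_fst (p := y r)).comp_hasDerivAt r (hy r hr).1
  have hy2 : ∀ r ∈ Ioo r₀ r₁, HasDerivAt (fun t => (y t).2)
      (pucciInv lam Lam (-(k / r * pucciMul lam Lam (y r).2) - g (y r).1)) r := fun r hr =>
    (hasFDerivAt_snd (p := y r)).comp_hasDerivAt r (hy r hr).1
  have hv1 : ∀ r ∈ Ioo r₀ r₁, HasDerivAt v (y r).2 r := fun r hr =>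
    (hy1 r hr).congr_of_eventuallyEq (by
      filter_upwards [Ioo_mem_nhds hr.1 hr.2] with t ht using hvy t ht)
  have hv2 : ∀ r ∈ Ioo r₀ r₁, HasDerivAt (deriv v)
      (pucciInv lam Lam (-(k / r * pucciMul lam Lam (y r).2) - g (y r).1)) r := fun r hr =>
    (hy2 r hr).congr_of_eventuallyEq (by
      filter_upwards [Ioo_mem_nhds hr.1 hr.2] with t ht using (hv1 t ht).deriv)
  have hvsmooth : ContDiffOn ℝ 2 v (Ioo r₀ r₁) := by
    refine contDiffOn_two_of_hasDerivAt isOpen_Ioo hv1 hy2 ?_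
    refine continuous_pucciInv.comp_continuousOn (ContinuousOn.sub (ContinuousOn.neg
      (ContinuousOn.mul (continuousOn_const.div continuousOn_id fun t ht =>
        (hr₀.1.trans ht.1).ne') (continuous_pucciMul.comp_continuousOn
        (HasDerivAt.continuousOn hy2)))) (hg.continuous.comp_continuousOn
        (HasDerivAt.continuousOn hy1)))
  refine ⟨r₁, hr₁, v, fun r hr => ?_, fun r hr => ?_, hvu⟩
  · rcases lt_or_ge r ρ with h | h
    · have h1 : ContDiffWithinAt ℝ 2 u (Ico 0 r₁) r :=
        (hu r ⟨hr.1, h⟩).mono_of_mem_nhdsWithin (by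
          filter_upwards [self_mem_nhdsWithin, mem_nhdsWithin_of_mem_nhds (Iio_mem_nhds h)]
            with t ht ht' using ⟨ht.1, ht'⟩)
      refine h1.congr_of_eventuallyEq ?_ (hvu r h)
      filter_upwards [mem_nhdsWithin_of_mem_nhds (Iio_mem_nhds h)] with t ht using hvu t ht
    · exact (hvsmooth.contDiffAt (Ioo_mem_nhds (hr₀.2.trans_le h) hr.2)).contDiffWithinAt
  · rcases lt_or_ge r ρ with h | h
    · have e : v =ᶠ[𝓝 r] u := by
        filter_upwards [Iio_mem_nhds h] with t ht using hvu t ht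
      rw [e.deriv.deriv_eq, e.deriv_eq, hvu r h]
      exact hode r ⟨hr.1, h⟩
    · have hr' : r ∈ Ioo r₀ r₁ := ⟨hr₀.2.trans_le h, hr.2⟩
      rw [(hv2 r hr').deriv, (hv1 r hr').deriv, hvy r hr']

/-- A `C²` solution of the radial equation up to the origin starts with zero slope. -/
lemma tendsto_deriv_zero_of_pucci {lam Lam k : ℝ} (hlam : 0 < lam) (hle : lam ≤ Lam)
    (hk : 0 < k) {g u : ℝ → ℝ} (hg : Continuous g) {ρ : ℝ} (hρ : 0 < ρ)
    (hu : ContDiffOn ℝ 2 u (Icc 0 ρ))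
    (hode : ∀ r ∈ Ioo 0 ρ, (if 0 ≤ deriv (deriv u) r then Lam else lam) * deriv (deriv u) r
      + k / r * ((if 0 ≤ deriv u r then Lam else lam) * deriv u r) + g (u r) = 0) :
    Tendsto (deriv u) (𝓝[>] 0) (𝓝 0) := by
  have hLam := hlam.trans_le hle
  set I := Icc 0 ρ
  have hI : UniqueDiffOn ℝ I := uniqueDiffOn_Icc hρ
  have hu' := hu
  rw [show (2 : WithTop ℕ∞) = 0 + 1 + 1 by norm_num, contDiffOn_succ_iff_derivWithin hI,
    contDiffOn_succ_iff_derivWithin hI, contDiffOn_zero] at hu'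
  have hq : ContinuousOn (derivWithin (derivWithin u I) I) I := hu'.2.2.2.2
  have e1 : ∀ r ∈ Ioo 0 ρ, derivWithin u I r = deriv u r := fun r hr =>
    derivWithin_of_mem_nhds (Icc_mem_nhds hr.1 hr.2)
  have e2 : ∀ r ∈ Ioo 0 ρ, derivWithin (derivWithin u I) I r = deriv (deriv u) r := fun r hr => by
    rw [derivWithin_of_mem_nhds (Icc_mem_nhds hr.1 hr.2)]
    refine Filter.EventuallyEq.deriv_eq ?_
    filter_upwards [Ioo_mem_nhds hr.1 hr.2] with t ht using e1 t ht
  obtain ⟨C, hC⟩ := isCompact_Icc.exists_bound_of_continuousOn hq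
  obtain ⟨D, hD⟩ := isCompact_Icc.exists_bound_of_continuousOn
    (hg.comp_continuousOn hu.continuousOn)
  have hbound : ∀ r ∈ Ioo 0 ρ, |deriv u r| ≤ (Lam * C + D) / (k * lam) * r := by
    intro r hr
    have h1 := hC r (Ioo_subset_Icc_self hr)
    have h2 := hD r (Ioo_subset_Icc_self hr)
    rw [e2 r hr, Real.norm_eq_abs] at h1
    rw [Real.norm_eq_abs] at h2
    have h3 := hode r hr
    rw [← pucciMul_eq_ite hle, ← pucciMul_eq_ite hle] at h3
    have h4 := abs_pucciMul_le hlam hle (deriv (deriv u) r)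
    have h5 := le_abs_pucciMul hle (deriv u r)
    have h6 : k / r * |pucciMul lam Lam (deriv u r)| ≤ Lam * C + D := by
      rw [← abs_of_pos (div_pos hk hr.1), ← abs_mul,
        show k / r * pucciMul lam Lam (deriv u r)
          = -(pucciMul lam Lam (deriv (deriv u) r) + g (u r)) by linarith, abs_neg]
      refine (abs_add_le _ _).trans (add_le_add (h4.trans ?_) h2)
      exact mul_le_mul_of_nonneg_left h1 hLam.le
    have h7 : k / r * (lam * |deriv u r|) ≤ Lam * C + D :=
      (mul_le_mul_of_nonneg_left h5 (div_pos hk hr.1).le).trans h6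
    rw [div_mul_eq_mul_div, le_div_iff₀ (by positivity)]
    rw [div_mul_eq_mul_div, div_le_iff₀ hr.1] at h7
    linarith
  have hlim : Tendsto (fun r => (Lam * C + D) / (k * lam) * r) (𝓝[>] 0) (𝓝 0) := by
    have : Tendsto (fun r => (Lam * C + D) / (k * lam) * r) (𝓝 0)
        (𝓝 ((Lam * C + D) / (k * lam) * 0)) := tendsto_id.const_mul _
    rw [mul_zero] at this
    exact this.mono_left nhdsWithin_le_nhds
  refine squeeze_zero_norm' ?_ hlim
  filter_upwards [Ioo_mem_nhdsGT hρ] with r hr using hbound r hr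

section Potential

variable {lam Lam α : ℝ} {g : ℝ → ℝ}

/-- The force `t ↦ -pucciInv (-g t)` points to the origin on `(-α, α)`. -/
lemma mul_pucci_force_pos (hlam : 0 < lam) (hle : lam ≤ Lam) (hodd : ∀ t, g (-t) = -g t)
    (hpos : ∀ t, 0 < t → t < α → 0 < g t) {x : ℝ} (hx : |x| < α) (hx0 : x ≠ 0) :
    0 < x * -pucciInv lam Lam (-g x) := by
  have hLam := hlam.trans_le hle
  rcases lt_or_gt_of_ne hx0 with h | h
  · have h1 := hpos (-x) (by linarith) (by rwa [abs_of_neg h] at hx)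
    rw [hodd] at h1
    rw [pucciInv_of_nonneg hlam hle h1.le]
    exact mul_pos_of_neg_of_neg h (neg_neg_of_pos (by positivity))
  · have h1 := hpos x h (by rwa [abs_of_pos h] at hx)
    rw [pucciInv_of_nonpos hlam hle (by linarith), neg_div, neg_neg]
    positivity

lemma exists_sq_le_mul_pucci_force (hlam : 0 < lam) (hle : lam ≤ Lam) (hg0 : g 0 = 0) {g' : ℝ}
    (hg' : HasDerivAt g g' 0) (hg'pos : 0 < g') :
    ∃ c > 0, ∀ᶠ x in 𝓝 (0 : ℝ), c * x ^ 2 ≤ x * -pucciInv lam Lam (-g x) := by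
  have hLam := hlam.trans_le hle
  refine ⟨g' / 2 / Lam, by positivity, ?_⟩
  have h1 := hg'.isLittleO.def (half_pos hg'pos)
  filter_upwards [h1] with x hx
  simp only [hg0, sub_zero, smul_eq_mul, Real.norm_eq_abs] at hx
  have hx' := abs_le.1 hx
  rcases le_total 0 x with h | h
  · rw [abs_of_nonneg h] at hx'
    have h2 : g' / 2 * x ≤ g x := by linarith [hx'.1]
    have h3 : 0 ≤ g x := le_trans (by positivity) h2
    rw [pucciInv_of_nonpos hlam hle (by linarith), neg_div, neg_neg]
    have h4 : g' / 2 * x / Lam ≤ g x / lam := div_le_div₀ h3 h2 hlam hle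
    calc _ = x * (g' / 2 * x / Lam) := by ring
      _ ≤ _ := mul_le_mul_of_nonneg_left h4 h
  · rw [abs_of_nonpos h] at hx'
    have h2 : g' / 2 * (-x) ≤ -g x := by linarith [hx'.2]
    have h3 : 0 ≤ -g x := le_trans (mul_nonneg (by positivity) (by linarith)) h2
    rw [pucciInv_of_nonneg hlam hle h3]
    have h4 : g' / 2 * (-x) / Lam ≤ -g x / Lam := div_le_div_of_nonneg_right h2 hLam.le
    calc _ = -x * (g' / 2 * (-x) / Lam) := by ring
      _ ≤ -x * (-g x / Lam) := mul_le_mul_of_nonneg_left h4 (by linarith)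
      _ = _ := by ring

lemma exists_pucci_potential (hlam : 0 < lam) (hle : lam ≤ Lam) (hg : Continuous g)
    (hα : 0 < α) (hodd : ∀ t, g (-t) = -g t) (hpos : ∀ t, 0 < t → t < α → 0 < g t) {ξ : ℝ}
    (hξ0 : 0 < ξ) (hξα : ξ < α)
    (hGle : Lam * ∫ s in (0 : ℝ)..ξ, g s ≤ lam * ∫ s in (0 : ℝ)..α, g s) :
    ∃ H : ℝ → ℝ, (∀ t, HasDerivAt H (-pucciInv lam Lam (-g t)) t) ∧ H 0 = 0 ∧
      (∀ x, |x| ≤ α → x ≠ 0 → 0 < H x) ∧ ∀ x, |x| = α → H ξ ≤ H x := by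
  have hLam := hlam.trans_le hle
  set h : ℝ → ℝ := fun t => -pucciInv lam Lam (-g t) with hh
  have hc : Continuous h := (continuous_pucciInv.comp hg.neg).neg
  set H : ℝ → ℝ := fun x => ∫ t in (0 : ℝ)..x, h t with hHdef
  have hH : ∀ t, HasDerivAt H (h t) t := fun t =>
    (hc.integral_hasStrictDerivAt 0 t).hasDerivAt
  have hHc : Continuous H := continuous_iff_continuousAt.2 fun t => (hH t).continuousAt
  have hH0 : H 0 = 0 := by simp [hHdef]
  have hg0 : g 0 = 0 := by have := hodd 0; rw [neg_zero] at this; linarith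
  have hgα : 0 ≤ g α := by
    refine ge_of_tendsto (hg.continuousAt.tendsto.mono_left nhdsWithin_le_nhds :
      Tendsto g (𝓝[<] α) (𝓝 (g α))) ?_
    filter_upwards [Ioo_mem_nhdsLT hα] with t ht using (hpos t ht.1 ht.2).le
  have hgnn : ∀ t ∈ Icc 0 α, 0 ≤ g t := fun t ht => by
    rcases ht.1.eq_or_lt with rfl | h1
    · exact hg0.ge
    · rcases ht.2.eq_or_lt with rfl | h2
      · exact hgα
      · exact (hpos t h1 h2).le
  have hmul : ∀ x, |x| < α → x ≠ 0 → 0 < x * h x := fun x hx hx0 =>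
    mul_pucci_force_pos hlam hle hodd hpos hx hx0
  have hmono : StrictMonoOn H (Icc 0 α) := by
    refine strictMonoOn_of_deriv_pos (convex_Icc _ _) hHc.continuousOn fun x hx => ?_
    rw [interior_Icc] at hx
    rw [(hH x).deriv]
    exact pos_of_mul_pos_right (hmul x (by rw [abs_of_pos hx.1]; exact hx.2) hx.1.ne') hx.1.le
  have hanti : StrictAntiOn H (Icc (-α) 0) := by
    refine strictAntiOn_of_deriv_neg (convex_Icc _ _) hHc.continuousOn fun x hx => ?_
    rw [interior_Icc] at hx
    rw [(hH x).deriv]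
    have := hmul x (by rw [abs_of_neg hx.2]; linarith [hx.1]) hx.2.ne
    exact neg_of_mul_pos_right this hx.2.le
  have hHpos : ∀ x ∈ Icc 0 α, H x = (∫ s in (0 : ℝ)..x, g s) / lam := fun x hx => by
    rw [← intervalIntegral.integral_div]
    refine intervalIntegral.integral_congr fun t ht => ?_
    rw [uIcc_of_le hx.1] at ht
    simp only [hh]
    rw [pucciInv_of_nonpos hlam hle (neg_nonpos.2 (hgnn t ⟨ht.1, ht.2.trans hx.2⟩)), neg_div,
      neg_neg]
  have hHneg : H (-α) = (∫ s in (0 : ℝ)..α, g s) / Lam := by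
    have h1 : ∫ t in (0 : ℝ)..α, h (-t) = ∫ t in (0 : ℝ)..α, -(g t / Lam) := by
      refine intervalIntegral.integral_congr fun t ht => ?_
      rw [uIcc_of_le hα.le] at ht
      simp only [hh]
      rw [hodd, neg_neg, pucciInv_of_nonneg hlam hle (hgnn t ht)]
    have h2 : H (-α) = -∫ t in (0 : ℝ)..α, h (-t) := by
      rw [intervalIntegral.integral_comp_neg, neg_zero, ← intervalIntegral.integral_symm]
    rw [h2, h1, intervalIntegral.integral_neg, intervalIntegral.integral_div, neg_neg]
  refine ⟨H, hH, hH0, fun x hx hx0 => ?_, fun x hx => ?_⟩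
  · have hx' := abs_le.1 hx
    rw [← hH0]
    rcases lt_or_gt_of_ne hx0 with h | h
    · exact hanti ⟨hx'.1, h.le⟩ ⟨by linarith, le_rfl⟩ h
    · exact hmono ⟨le_rfl, hα.le⟩ ⟨h.le, hx'.2⟩ h
  · rcases (abs_eq hα.le).1 hx with rfl | rfl
    · exact (hmono ⟨hξ0.le, hξα.le⟩ ⟨hα.le, le_rfl⟩ hξα).le
    · rw [hHneg, hHpos ξ ⟨hξ0.le, hξα.le⟩, div_le_div_iff₀ hlam hLam]
      linarith

end Potential

theorem pucci_radial_plus_oscillating_positive_data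
    (lam Lam : ℝ) (hlam : 0 < lam) (hlamLam : lam ≤ Lam)
    (N : ℕ) (hN : 2 ≤ N)
    (g : ℝ → ℝ) (hg1 : LocallyLipschitz g)
    (hg2 : ∀ t, g (-t) = - g t)
    (α : ℝ) (hα : 0 < α)
    (hg3pos : ∀ t, 0 < t → t < α → 0 < g t)
    (hg3neg : ∀ t, α < t → g t < 0)
    (g'0 : ℝ) (hg4 : HasDerivAt g g'0 0) (hg4pos : 0 < g'0)
    (G : ℝ → ℝ) (hG : ∀ t, G t = ∫ s in (0:ℝ)..t, g s)
    (ξ : ℝ) (hξ0 : 0 < ξ) (hξα : ξ < α)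
    (hGle : Lam * G ξ ≤ lam * G α)
    (R : EReal) (hR : 0 < R)
    (u : ℝ → ℝ)
    (hu : ContDiffOn ℝ 2 u {r : ℝ | 0 ≤ r ∧ (r : EReal) < R})
    (hode : ∀ r : ℝ, 0 < r → (r : EReal) < R →
      (if 0 ≤ deriv (deriv u) r then Lam else lam) * deriv (deriv u) r
        + ((N : ℝ) - 1) / r * ((if 0 ≤ deriv u r then Lam else lam) * deriv u r)
        + g (u r) = 0)
    (hu0 : u 0 = ξ) (hu'0 : deriv u 0 = 0)
    (hmax : ¬ ∃ (R' : EReal) (v : ℝ → ℝ), R < R' ∧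
      ContDiffOn ℝ 2 v {r : ℝ | 0 ≤ r ∧ (r : EReal) < R'} ∧
      (∀ r : ℝ, 0 < r → (r : EReal) < R' →
        (if 0 ≤ deriv (deriv v) r then Lam else lam) * deriv (deriv v) r
        + ((N : ℝ) - 1) / r * ((if 0 ≤ deriv v r then Lam else lam) * deriv v r)
        + g (v r) = 0) ∧
      v 0 = ξ ∧ deriv v 0 = 0 ∧
      (∀ r : ℝ, 0 ≤ r → (r : EReal) < R → v r = u r))
 :
    R = ⊤ ∧
    (∀ M : ℝ, ∃ r, M ≤ r ∧ u r = 0) ∧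
    Tendsto u atTop (𝓝 0) ∧ Tendsto (deriv u) atTop (𝓝 0) ∧
    Tendsto (deriv (deriv u)) atTop (𝓝 0) ∧
    sSup ((fun r => |u r|) '' Set.Ici 0) < α := by
  have hLam := hlam.trans_le hlamLam
  set k : ℝ := (N : ℝ) - 1 with hkdef
  have hk : 0 < k := by
    have : (2 : ℝ) ≤ N := by exact_mod_cast hN
    linarith
  have hg := hg1.continuous
  have hg0 : g 0 = 0 := by have := hg2 0; rw [neg_zero] at this; linarith
  set h : ℝ → ℝ := fun t => -pucciInv lam Lam (-g t) with hh
  have hhc : Continuous h := (continuous_pucciInv.comp hg.neg).neg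
  rw [hG, hG] at hGle
  obtain ⟨H, hH, hH0, hHpos, hHα⟩ :=
    exists_pucci_potential hlam hlamLam hg hα hg2 hg3pos hξ0 hξα hGle
  have hforce : ∀ x, |x| < α → x ≠ 0 → 0 < x * h x := fun x hx hx0 =>
    mul_pucci_force_pos hlam hlamLam hg2 hg3pos hx hx0
  have hξabs : |ξ| < α := by rwa [abs_of_pos hξ0]
  set I : Set ℝ := {r | 0 < r ∧ (r : EReal) < R} with hI
  have hIopen : IsOpen I :=
    isOpen_Ioi.inter (isOpen_Iio.preimage continuous_coe_real_ereal)
  obtain ⟨hd, hd', -⟩ := (contDiffOn_two_iff_deriv_of_isOpen hIopen).1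
    (hu.mono fun r hr => ⟨hr.1.le, hr.2⟩)
  have hup : ∀ r ∈ I, HasDerivAt u (deriv u r) r := fun r hr =>
    (hd.differentiableAt (hIopen.mem_nhds hr)).hasDerivAt
  have hpq : ∀ r ∈ I, HasDerivAt (deriv u) (deriv (deriv u) r) r := fun r hr =>
    (hd'.differentiableAt (hIopen.mem_nhds hr)).hasDerivAt
  have hq : ∀ r ∈ I, deriv (deriv u) r
      = pucciInv lam Lam (-(k / r * pucciMul lam Lam (deriv u r)) - g (u r)) := fun r hr =>
    (pucci_equation_iff hlam hlamLam).1 (hode r hr.1 hr.2)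
  have hIoc : ∀ r ∈ I, ∀ s ∈ Ioc 0 r, s ∈ I := fun r hr s hs =>
    ⟨hs.1, (EReal.coe_le_coe_iff.2 hs.2).trans_lt hr.2⟩
  set K : ℝ := k * Lam / lam with hK
  set κ : ℝ := k * lam / Lam with hκ
  have hK0 : 0 < K := by positivity
  have hκ0 : 0 < κ := by positivity
  have hA : ∀ r ∈ I, |deriv (deriv u) r + h (u r)| ≤ K * |deriv u r| / r := fun r hr => by
    have := (pucci_damping hlam hlamLam (div_nonneg hk.le hr.1.le) (deriv u r) (g (u r))).1
    rw [← hq r hr, sub_eq_add_neg] at this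
    refine this.trans_eq ?_
    rw [hK]; ring
  have hB : ∀ r ∈ I, deriv u r * (deriv (deriv u) r + h (u r)) ≤ -(κ * deriv u r ^ 2 / r) :=
    fun r hr => by
      have := (pucci_damping hlam hlamLam (div_nonneg hk.le hr.1.le) (deriv u r) (g (u r))).2
      rw [← hq r hr, sub_eq_add_neg] at this
      refine this.trans_eq ?_
      rw [hκ]; ring
  obtain ⟨ρ₀, hρ₀, hρ₀R⟩ : ∃ ρ : ℝ, 0 < ρ ∧ (ρ : EReal) < R := by
    obtain ⟨ρ, h1, h2⟩ := EReal.exists_between_coe_real hR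
    exact ⟨ρ, by exact_mod_cast h1, h2⟩
  have hρ₀I : ρ₀ ∈ I := ⟨hρ₀, hρ₀R⟩
  have hp0 : Tendsto (deriv u) (𝓝[>] 0) (𝓝 0) :=
    tendsto_deriv_zero_of_pucci hlam hlamLam hk hg hρ₀
      (hu.mono fun r hr => ⟨hr.1, (EReal.coe_le_coe_iff.2 hr.2).trans_lt hρ₀R⟩)
      fun r hr => hode r hr.1 (hIoc ρ₀ hρ₀I r ⟨hr.1, hr.2.le⟩).2
  have hu0lim : Tendsto u (𝓝[>] 0) (𝓝 ξ) := by
    rw [← hu0]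
    refine (hu.continuousOn 0 ⟨le_rfl, hR⟩).mono_left ?_
    refine le_inf nhdsWithin_le_nhds (le_principal_iff.2 ?_)
    filter_upwards [Ioc_mem_nhdsGT hρ₀] with r hr
    exact ⟨hr.1.le, (hIoc ρ₀ hρ₀I r hr).2⟩
  have henergy : ∀ r ∈ I, deriv u r ^ 2 / 2 + H (u r) < H ξ ∧ |u r| < α := fun r hr =>
    energy_lt_of_damped hr.1 hκ0 hhc hH
      (right_ne_zero_of_mul (hforce ξ hξabs hξ0.ne').ne')
      (fun s hs => hup s (hIoc r hr s hs)) (fun s hs => hpq s (hIoc r hr s hs))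
      (fun s hs => hA s (hIoc r hr s hs)) (fun s hs => hB s (hIoc r hr s hs))
      hu0lim hp0 hξabs hHα
  have hHnn : ∀ x, |x| ≤ α → 0 ≤ H x := fun x hx => by
    rcases eq_or_ne x 0 with rfl | h0
    · exact hH0.ge
    · exact (hHpos x hx h0).le
  have hpB : ∀ r ∈ I, |deriv u r| ≤ √(2 * H ξ) := fun r hr => by
    obtain ⟨h1, h2⟩ := henergy r hr
    exact Real.abs_le_sqrt (by linarith [hHnn _ h2.le])
  have hRtop : R = ⊤ := by
    by_contra hne
    obtain ⟨ρ, hRρ⟩ : ∃ ρ : ℝ, (ρ : EReal) = R :=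
      ⟨R.toReal, EReal.coe_toReal hne (bot_le.trans_lt hR).ne'⟩
    have hlt : ∀ r : ℝ, (r : EReal) < R ↔ r < ρ := fun r => by
      rw [← hRρ, EReal.coe_lt_coe_iff]
    have hρ : 0 < ρ := (hlt 0).1 hR
    have hmem : ∀ r ∈ Ioo 0 ρ, r ∈ I := fun r hr => ⟨hr.1, (hlt r).2 hr.2⟩
    obtain ⟨ρ', hρ', v, hv, hvode, hvu⟩ :=
      exists_pucci_continuation (A := max α (√(2 * H ξ))) hlam hlamLam hk.le hg1 hg0 hρ
      (hu.mono fun r hr => ⟨hr.1, (hlt r).2 hr.2⟩)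
      (fun r hr => hq r (hmem r hr)) (fun r hr => (henergy r (hmem r hr)).2.le.trans
        (le_max_left _ _)) (fun r hr => (hpB r (hmem r hr)).trans (le_max_right _ _))
    refine hmax ⟨ρ', v, hRρ ▸ EReal.coe_lt_coe_iff.2 hρ',
      hv.mono fun r hr => ⟨hr.1, EReal.coe_lt_coe_iff.1 hr.2⟩, fun r hr hr' =>
      (pucci_equation_iff hlam hlamLam).2 (hvode r ⟨hr, EReal.coe_lt_coe_iff.1 hr'⟩),
      (hvu 0 hρ).trans hu0, ?_, fun r _ hr => hvu r ((hlt r).1 hr)⟩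
    have e : v =ᶠ[𝓝 0] u := by
      filter_upwards [Iio_mem_nhds hρ] with t ht using hvu t ht
    rw [e.deriv_eq, hu'0]
  have hIall : ∀ r, 0 < r → r ∈ I := fun r hr => ⟨hr, hRtop ▸ EReal.coe_lt_top r⟩
  have hI1 : ∀ r, 1 ≤ r → r ∈ I := fun r hr => hIall r (one_pos.trans_le hr)
  have hEanti : ∀ r, 1 ≤ r →
      deriv u r ^ 2 / 2 + H (u r) ≤ deriv u 1 ^ 2 / 2 + H (u 1) := by
    have hEder : ∀ r, 1 ≤ r → HasDerivAt (fun r => deriv u r ^ 2 / 2 + H (u r))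
        (deriv u r * (deriv (deriv u) r + h (u r))) r := fun r hr => by
      refine ((((hpq r (hI1 r hr)).pow 2).div_const 2).add
        ((hH (u r)).comp r (hup r (hI1 r hr)))).congr_deriv ?_
      push_cast; ring
    have hanti : AntitoneOn (fun r => deriv u r ^ 2 / 2 + H (u r)) (Ici 1) := by
      apply antitoneOn_of_hasDerivWithinAt_nonpos (convex_Ici _)
        (HasDerivAt.continuousOn fun r hr => hEder r hr)
        (fun r hr => (hEder r (interior_subset hr)).hasDerivWithinAt)
      intro r hr
      have hr' : 1 ≤ r := interior_subset hr
      have : 0 ≤ κ * deriv u r ^ 2 / r := by positivity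
      linarith [hB r (hI1 r hr')]
    exact fun r hr => hanti self_mem_Ici hr hr
  obtain ⟨hulim, hplim⟩ := tendsto_zero_of_damped hα hκ0 hK0.le hhc hH hH0 hHpos
    (fun r hr => hup r (hI1 r hr)) (fun r hr => hpq r (hI1 r hr))
    (fun r hr => (henergy r (hI1 r hr)).2.le) (fun r hr => hpB r (hI1 r hr))
    (fun r hr => hA r (hI1 r hr)) (fun r hr => hB r (hI1 r hr)) hEanti
    (fun x hx hxE hx0 => hforce x (lt_of_le_of_ne hx fun heq => by
      linarith [hHα x heq, (henergy 1 (hI1 1 le_rfl)).1]) hx0)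
  have hqlim : Tendsto (deriv (deriv u)) atTop (𝓝 0) := by
    have h1 : Tendsto (fun r => h (u r)) atTop (𝓝 0) := by
      have h0 : h 0 = 0 := by simp [hh, hg0]
      rw [← h0]
      exact (hhc.tendsto 0).comp hulim
    have h2 : Tendsto (fun r => deriv (deriv u) r + h (u r)) atTop (𝓝 0) := by
      have h3 : Tendsto (fun r => K * |deriv u r|) atTop (𝓝 0) := by
        simpa using hplim.abs.const_mul K
      refine squeeze_zero_norm' ?_ h3
      filter_upwards [eventually_ge_atTop 1] with r hr
      exact (hA r (hI1 r hr)).trans (div_le_self (by positivity) hr)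
    simpa using h2.sub h1
  refine ⟨hRtop, fun M => ?_, hulim, hplim, hqlim, ?_⟩
  · obtain ⟨c, hc, hnear⟩ := exists_sq_le_mul_pucci_force hlam hlamLam hg0 hg4 hg4pos
    obtain ⟨M', hM'⟩ := eventually_atTop.1 (hulim.eventually hnear)
    have hle1 : 1 ≤ max 1 (max M M') := le_max_left _ _
    obtain ⟨r, hr, hr0⟩ := exists_zero_of_mul_deriv2_le (M := max 1 (max M M')) (K := K)
      (one_pos.trans_le hle1) hc
      (fun r hr => hup r (hI1 r (hle1.trans hr))) (fun r hr => hpq r (hI1 r (hle1.trans hr)))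
      fun r hr => by
        have h1 := hM' r (((le_max_right _ _).trans (le_max_right _ _)).trans hr)
        have h2 := mul_le_mul_of_nonneg_left (hA r (hI1 r (hle1.trans hr))) (abs_nonneg (u r))
        rw [← abs_mul] at h2
        have h3 := (le_abs_self _).trans h2
        have h4 : |u r| * (K * |deriv u r| / r) = K / r * |u r * deriv u r| := by
          rw [abs_mul]; ring
        rw [h4, mul_add] at h3
        linarith
    exact ⟨r, ((le_max_left _ _).trans (le_max_right _ _)).trans hr, hr0⟩
  · obtain ⟨M, hM⟩ := eventually_atTop.1 (hulim.abs.eventually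
      (ge_mem_nhds (by rw [abs_zero]; exact half_pos hα : |(0 : ℝ)| < α / 2)))
    have hlt : ∀ r, 0 ≤ r → |u r| < α := fun r hr => by
      rcases hr.eq_or_lt with rfl | h0
      · rwa [hu0]
      · exact (henergy r (hIall r h0)).2
    have hcont : ContinuousOn (fun r => |u r|) (Icc 0 (max M 0)) :=
      (hu.continuousOn.mono fun r hr => ⟨hr.1, hRtop ▸ EReal.coe_lt_top r⟩).abs
    obtain ⟨s, hs, hmaxs⟩ := isCompact_Icc.exists_isMaxOn
      (nonempty_Icc.2 (le_max_right M 0)) hcont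
    refine (csSup_le (nonempty_Ici.image _) ?_).trans_lt
      (max_lt (hlt s hs.1) (half_lt_self hα))
    rintro _ ⟨r, hr, rfl⟩
    rcases le_total r (max M 0) with hrM | hrM
    · exact (hmaxs ⟨hr, hrM⟩).trans (le_max_left _ _)
    · exact (hM r ((le_max_left _ _).trans hrM)).trans (le_max_right _ _)
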